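/- Let n1, n2, n3 be positive integers, let A be a complex third-order tensor with frontal slices A_1,…,A_{n3} ∈ ℂ^{n1×n2}, and let F = F_{n3} be the n3×n3 DFT matrix with entries (F)_{jk} = ω^{(j−1)(k−1)}, where ω = exp(−2πi/n3). Then (F ⊗ I_{n1}) · bcirc(A) · (F^{−1} ⊗ I_{n2}) is the block diagonal matrix BlockDiag(Â^(1),…,Â^(n3)), where Â^(i) = Σ_{k=1}^{n3} ω^{(i−1)(k−1)} A_k is the i-th Fourier slice of A. -/

import Mathlib

open scoped Matrix Kronecker

noncomputable section

namespace TTensor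

/-- Complex block-circulant matrix, with blocks laid out so that rows/columns are
indexed by (block index, within-block index); block `(i, j)` is `A ((i - j) mod n3)`. -/
def bcircC {n1 n2 n3 : ℕ} (A : Fin n3 → Matrix (Fin n1) (Fin n2) ℂ) :
    Matrix (Fin n3 × Fin n1) (Fin n3 × Fin n2) ℂ :=
  Matrix.of fun ti tj => A (ti.1 - tj.1) ti.2 tj.2

/-- The `t`-th Fourier slice of a complex third-order tensor. -/
def fourierSliceC {n1 n2 n3 : ℕ} (A : Fin n3 → Matrix (Fin n1) (Fin n2) ℂ)
    (t : Fin n3) : Matrix (Fin n1) (Fin n2) ℂ :=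
  ∑ k : Fin n3,
    Complex.exp (-(2 * (Real.pi : ℂ) * Complex.I) / (n3 : ℂ)) ^ ((t : ℕ) * (k : ℕ)) • A k

/-- The Fourier matrix of a primitive `n`-th root of unity is invertible. -/
theorem isUnit_det_of_primitiveRoot_pow {n : ℕ} {ω : ℂ} (hω : IsPrimitiveRoot ω n) :
    IsUnit (Matrix.of fun j k : Fin n => ω ^ ((j : ℕ) * (k : ℕ))).det := by
  have hV : (Matrix.of fun j k : Fin n => ω ^ ((j : ℕ) * (k : ℕ))) =
      Matrix.vandermonde fun j : Fin n => ω ^ (j : ℕ) := by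
    ext j k
    simp [Matrix.vandermonde_apply, pow_mul]
  rw [hV, isUnit_iff_ne_zero, Matrix.det_vandermonde_ne_zero_iff]
  exact fun i j h => Fin.ext (hω.pow_inj i.2 j.2 h)

/-- Characters of `Fin n` turn cyclic shifts into scalar multiplication. -/
theorem sum_pow_mul_cyclic_shift {R : Type*} [CommSemiring R] {n : ℕ} {ω : R} (hω : ω ^ n = 1)
    (f : Fin n → R) (t : ℕ) (j : Fin n) :
    ∑ i : Fin n, ω ^ (t * (i : ℕ)) * f (i - j) =
      (∑ k : Fin n, ω ^ (t * (k : ℕ)) * f k) * ω ^ (t * (j : ℕ)) := by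
  have : NeZero n := ⟨j.pos.ne'⟩
  have hωt : (ω ^ t) ^ n = 1 := by rw [← pow_mul, mul_comm, pow_mul, hω, one_pow]
  rw [← Equiv.sum_comp (Equiv.addRight j), Finset.sum_mul]
  refine Finset.sum_congr rfl fun k _ => ?_
  rw [Equiv.coe_addRight, add_sub_cancel_right, pow_mul, Fin.val_add, ← pow_eq_pow_mod _ hωt,
    pow_add, ← pow_mul, ← pow_mul]
  ring

/-- `(F ⊗ I_{n1}) · bcirc(A) · (F⁻¹ ⊗ I_{n2})` is the block-diagonal
matrix whose diagonal blocks are the Fourier slices of `A`. -/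
theorem blockDiagonalization_of_bcirc {n1 n2 n3 : ℕ}
    (hn1 : 0 < n1) (hn2 : 0 < n2) (hn3 : 0 < n3)
    (A : Fin n3 → Matrix (Fin n1) (Fin n2) ℂ)
    (F : Matrix (Fin n3) (Fin n3) ℂ)
    (hF : ∀ j k : Fin n3,
      F j k = Complex.exp (-(2 * (Real.pi : ℂ) * Complex.I) / (n3 : ℂ)) ^ ((j : ℕ) * (k : ℕ))) :
    (F ⊗ₖ (1 : Matrix (Fin n1) (Fin n1) ℂ)) * bcircC A *
        (F⁻¹ ⊗ₖ (1 : Matrix (Fin n2) (Fin n2) ℂ)) =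
      Matrix.of fun (ti : Fin n3 × Fin n1) (tj : Fin n3 × Fin n2) =>
        if ti.1 = tj.1 then fourierSliceC A ti.1 ti.2 tj.2 else 0 := by
  set ω := Complex.exp (-(2 * (Real.pi : ℂ) * Complex.I) / (n3 : ℂ)) with hω_def
  have hω : IsPrimitiveRoot ω n3 := by
    rw [hω_def, neg_div, Complex.exp_neg]
    exact (Complex.isPrimitiveRoot_exp n3 hn3.ne').inv
  have hdet : IsUnit F.det := by
    rw [show F = Matrix.of fun j k : Fin n3 => ω ^ ((j : ℕ) * (k : ℕ)) from Matrix.ext hF]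
    exact isUnit_det_of_primitiveRoot_pow hω
  set D : Matrix (Fin n3 × Fin n1) (Fin n3 × Fin n2) ℂ :=
    Matrix.of fun ti tj => if ti.1 = tj.1 then fourierSliceC A ti.1 ti.2 tj.2 else 0 with hD
  have hcomm : (F ⊗ₖ (1 : Matrix (Fin n1) (Fin n1) ℂ)) * bcircC A =
      D * (F ⊗ₖ (1 : Matrix (Fin n2) (Fin n2) ℂ)) := by
    ext ⟨t, a⟩ ⟨j, b⟩
    have hshift := sum_pow_mul_cyclic_shift hω.pow_eq_one (fun k => A k a b) t j
    simpa [Matrix.mul_apply, Fintype.sum_prod_type, Matrix.one_apply, bcircC, hD, fourierSliceC,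
      hF, Matrix.sum_apply, ← hω_def] using hshift
  rw [hcomm, Matrix.mul_assoc, ← Matrix.mul_kronecker_mul, Matrix.mul_nonsing_inv _ hdet,
    Matrix.one_mul, Matrix.one_kronecker_one, Matrix.mul_one]

end TTensor
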